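/- For every finite set of interactions γ and every history-clock valuation h : A → ℝ, ℰ(γ)(h) holds if and only if there exists an interaction-history-clock valuation H : Finset A → ℝ such that for every action a ∈ Act(γ), h a equals the minimum of H α over the (nonempty, finite) set of interactions α ∈ γ with a ∈ α. -/

import Mathlib

variable {A : Type*} [DecidableEq A]

/-- The set of actions involved in a set of interactions. -/
def Act (γ : Finset (Finset A)) : Finset A := γ.sup id

/-- `γ ⊖ α`: eliminate from every interaction of `γ` the actions of `α`. -/
def ominus (γ : Finset (Finset A)) (α : Finset A) : Finset (Finset A) :=
  (γ.filter (fun β => ¬ β ⊆ α)).image (fun β => β \ α)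

lemma ominus_card_lt {γ : Finset (Finset A)} {α : Finset A} (hα : α ∈ γ) :
    (ominus γ α).card < γ.card := by
  calc (ominus γ α).card ≤ (γ.filter (fun β => ¬ β ⊆ α)).card := Finset.card_image_le
    _ ≤ (γ.erase α).card := Finset.card_le_card (by
        intro β hβ
        rw [Finset.mem_filter] at hβ
        exact Finset.mem_erase.mpr ⟨fun h => hβ.2 (h ▸ Finset.Subset.refl α), hβ.1⟩)
    _ < γ.card := Finset.card_erase_lt_of_mem hα

/-- The interaction inequalities `ℰ(γ)` on history clocks. -/
def IE (γ : Finset (Finset A)) (h : A → ℝ) : Prop :=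
  γ = ∅ ∨ ∃ α, ∃ _ : α ∈ γ,
    (∀ ai ∈ α, ∀ aj ∈ α, h ai = h aj) ∧
    (∀ ai ∈ α, ∀ ak ∈ Act (ominus γ α), h ai ≤ h ak) ∧
    IE (ominus γ α) h
termination_by γ.card
decreasing_by exact ominus_card_lt (by assumption)

lemma filter_mem_nonempty {γ : Finset (Finset A)} {a : A} (ha : a ∈ Act γ) :
    (γ.filter (fun α => a ∈ α)).Nonempty := by
  obtain ⟨α, hαγ, hαa⟩ := Finset.mem_sup.mp ha
  exact ⟨α, Finset.mem_filter.mpr ⟨hαγ, hαa⟩⟩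

lemma mem_Act_iff {γ : Finset (Finset A)} {a : A} : a ∈ Act γ ↔ ∃ β ∈ γ, a ∈ β := by
  simp [Act, Finset.mem_sup]

lemma mem_ominus_iff {γ : Finset (Finset A)} {α δ : Finset A} :
    δ ∈ ominus γ α ↔ ∃ β ∈ γ, ¬ β ⊆ α ∧ β \ α = δ := by
  simp [ominus, and_assoc]

lemma mem_Act_ominus_iff {γ : Finset (Finset A)} {α : Finset A} {a : A} :
    a ∈ Act (ominus γ α) ↔ a ∈ Act γ ∧ a ∉ α := by
  simp only [mem_Act_iff, mem_ominus_iff]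
  constructor
  · rintro ⟨δ, ⟨β, hβ, -, rfl⟩, ha⟩
    rw [Finset.mem_sdiff] at ha
    exact ⟨⟨β, hβ, ha.1⟩, ha.2⟩
  · rintro ⟨⟨β, hβ, hb⟩, ha⟩
    exact ⟨β \ α, ⟨β, hβ, fun hs => ha (hs hb), rfl⟩, Finset.mem_sdiff.2 ⟨hb, ha⟩⟩

/-- Every action is a maximum of some interaction containing it. -/
def EveryActionTop (γ : Finset (Finset A)) (h : A → ℝ) : Prop :=
  ∀ a ∈ Act γ, ∃ α ∈ γ, a ∈ α ∧ ∀ b ∈ α, h b ≤ h a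

lemma IE_iff_isTop (h : A → ℝ) (n : ℕ) : ∀ γ : Finset (Finset A), γ.card = n →
    (∀ β ∈ γ, β.Nonempty) → (IE γ h ↔ EveryActionTop γ h) := by
  induction n using Nat.strong_induction_on with
  | _ n ih =>
  intro γ hn hγ
  have ih' : ∀ α ∈ γ, (IE (ominus γ α) h ↔ EveryActionTop (ominus γ α) h) := by
    intro α hα
    refine ih _ (hn ▸ ominus_card_lt hα) _ rfl ?_
    intro δ hδ
    obtain ⟨β, hβ, hs, rfl⟩ := mem_ominus_iff.1 hδ
    exact Finset.sdiff_nonempty.2 hs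
  rw [IE]
  constructor
  · rintro (rfl | ⟨α, hα, h1, h2, h3⟩)
    · intro a ha
      simp [Act] at ha
    · rw [ih' α hα] at h3
      intro a ha
      by_cases haα : a ∈ α
      · exact ⟨α, hα, haα, fun b hb => (h1 b hb a haα).le⟩
      · have ha' := mem_Act_ominus_iff.2 ⟨ha, haα⟩
        obtain ⟨δ, hδ, haδ, hmax⟩ := h3 a ha'
        obtain ⟨β, hβ, hs, rfl⟩ := mem_ominus_iff.1 hδ
        refine ⟨β, hβ, (Finset.mem_sdiff.1 haδ).1, fun b hb => ?_⟩
        by_cases hbα : b ∈ α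
        · exact h2 b hbα a ha'
        · exact hmax b (Finset.mem_sdiff.2 ⟨hb, hbα⟩)
  · intro hT
    rcases γ.eq_empty_or_nonempty with h0 | ⟨β₀, hβ₀⟩
    · exact Or.inl h0
    right
    obtain ⟨a₀, ha₀⟩ := hγ β₀ hβ₀
    obtain ⟨a, ha, hmin⟩ := Finset.exists_min_image (Act γ) h ⟨a₀, mem_Act_iff.2 ⟨β₀, hβ₀, ha₀⟩⟩
    obtain ⟨α, hα, haα, hmax⟩ := hT a ha
    have heq : ∀ b ∈ α, h b = h a := fun b hb =>
      le_antisymm (hmax b hb) (hmin b (mem_Act_iff.2 ⟨α, hα, hb⟩))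
    refine ⟨α, hα, fun b hb c hc => (heq b hb).trans (heq c hc).symm, fun b hb c hc => ?_, ?_⟩
    · rw [heq b hb]
      exact hmin c (mem_Act_ominus_iff.1 hc).1
    · rw [ih' α hα]
      intro c hc
      obtain ⟨hc1, hc2⟩ := mem_Act_ominus_iff.1 hc
      obtain ⟨β, hβ, hcβ, hm⟩ := hT c hc1
      exact ⟨β \ α, mem_ominus_iff.2 ⟨β, hβ, fun hs => hc2 (hs hcβ), rfl⟩,
        Finset.mem_sdiff.2 ⟨hcβ, hc2⟩, fun b hb => hm b (Finset.mem_sdiff.1 hb).1⟩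

/-- ℰ(γ)(h) holds iff there is an interaction-history-clock
valuation H such that every action history clock h a (for a ∈ Act(γ)) is the
minimum of the clocks H α of the interactions α ∈ γ containing a. -/
theorem IE_iff_exists_interaction_clocks (γ : Finset (Finset A))
    (hγ : ∀ β ∈ γ, β.Nonempty) (h : A → ℝ) :
    IE γ h ↔ ∃ H : Finset A → ℝ, ∀ (a : A) (ha : a ∈ Act γ),
      h a = ((γ.filter (fun α => a ∈ α)).image H).min'
              ((filter_mem_nonempty ha).image H) := by
  rw [IE_iff_isTop h _ γ rfl hγ]
  constructor
  · intro hT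
    refine ⟨fun α => if hα : α.Nonempty then α.sup' hα h else 0, fun a ha => ?_⟩
    apply le_antisymm
    · apply Finset.le_min'
      intro y hy
      obtain ⟨β, hβ, rfl⟩ := Finset.mem_image.1 hy
      have hb := (Finset.mem_filter.1 hβ).2
      rw [dif_pos ⟨a, hb⟩]
      exact Finset.le_sup' h hb
    · obtain ⟨α, hα, haα, hmax⟩ := hT a ha
      refine (Finset.min'_le _ _ (Finset.mem_image_of_mem _
        (Finset.mem_filter.2 ⟨hα, haα⟩))).trans ?_
      rw [dif_pos ⟨a, haα⟩]
      exact Finset.sup'_le _ _ hmax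
  · rintro ⟨H, hH⟩ a ha
    have hmem := Finset.min'_mem _ ((filter_mem_nonempty ha).image H)
    rw [← hH a ha] at hmem
    obtain ⟨α, hα, hHa⟩ := Finset.mem_image.1 hmem
    obtain ⟨hα, haα⟩ := Finset.mem_filter.1 hα
    refine ⟨α, hα, haα, fun b hb => ?_⟩
    rw [← hHa, hH b (mem_Act_iff.2 ⟨α, hα, hb⟩)]
    exact Finset.min'_le _ _ (Finset.mem_image_of_mem _ (Finset.mem_filter.2 ⟨hα, hb⟩))
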